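/- Let N ≥ 1 and let x_1, …, x_N be points on the unit sphere S² ⊂ ℝ³. Then (∫_{S²} ∏_{i=1}^N ‖p − x_i‖² dσ(p))^{1/2} ≥ e^{−κN}, where κ = 1/2 − log 2; equivalently, ∫_{S²} ∏_{i=1}^N ‖p − x_i‖² dσ(p) ≥ (4/e)^N. -/

import Mathlib

open MeasureTheory Finset

/-- The rotation-invariant surface measure on the unit sphere `S² ⊂ ℝ³`,
normalized to be a probability measure. -/
noncomputable def sphMeasure : Measure (Metric.sphere (0 : EuclideanSpace ℝ (Fin 3)) 1) :=
  ((volume : Measure (EuclideanSpace ℝ (Fin 3))).toSphere Set.univ)⁻¹ •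
    (volume : Measure (EuclideanSpace ℝ (Fin 3))).toSphere

open Real Set in
/-- Cylindrical coordinates for functions on `ℝ³` symmetric about the first axis. -/
theorem lintegral_axisymmetric {H : ℝ × ℝ → ENNReal} (hH : Measurable H) :
    ∫⁻ y : EuclideanSpace ℝ (Fin 3), H (y 0, y 1 ^ 2 + y 2 ^ 2) =
      ENNReal.ofReal (2 * π) *
        ∫⁻ z : ℝ, ∫⁻ ρ in Ioi (0 : ℝ), ENNReal.ofReal ρ * H (z, ρ ^ 2) := by
  have e1 := (PiLp.volume_preserving_ofLp (Fin 3)).lintegral_comp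
    (f := fun v : Fin 3 → ℝ => H (v 0, v 1 ^ 2 + v 2 ^ 2)) (by fun_prop)
  have e2 := (volume_preserving_piFinSuccAbove (fun _ : Fin 3 => ℝ) 0).lintegral_comp
    (f := fun p : ℝ × (Fin 2 → ℝ) => H (p.1, p.2 0 ^ 2 + p.2 1 ^ 2)) (by fun_prop)
  refine e1.trans (e2.trans ?_)
  rw [Measure.volume_eq_prod, lintegral_prod _ (by fun_prop),
    ← lintegral_const_mul _ (by fun_prop)]
  refine lintegral_congr fun z => ?_
  have e3 := (volume_preserving_finTwoArrow ℝ).lintegral_comp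
    (f := fun p : ℝ × ℝ => H (z, p.1 ^ 2 + p.2 ^ 2)) (by fun_prop)
  refine e3.trans ?_
  rw [← lintegral_comp_polarCoord_symm]
  simp only [polarCoord_target, polarCoord_symm_apply, smul_eq_mul]
  rw [Measure.volume_eq_prod, setLIntegral_prod _ (by fun_prop),
    ← lintegral_const_mul _ (by fun_prop)]
  refine lintegral_congr fun ρ => ?_
  have h : ∀ θ : ℝ, (ρ * cos θ) ^ 2 + (ρ * sin θ) ^ 2 = ρ ^ 2 := fun θ => by
    linear_combination ρ ^ 2 * sin_sq_add_cos_sq θ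
  simp only [h, lintegral_const, Measure.restrict_apply_univ, Real.volume_Ioo]
  rw [mul_comm]
  congr 2
  ring

open Real Set in
/-- Polar coordinates in the upper half-plane. -/
theorem lintegral_halfPlane_polar {K : ℝ × ℝ → ENNReal} (hK : Measurable K) :
    ∫⁻ z : ℝ, ∫⁻ ρ in Ioi (0 : ℝ), K (z, ρ) =
      ∫⁻ s in Ioi (0 : ℝ), ∫⁻ φ in Icc 0 π, ENNReal.ofReal s * K (s * cos φ, s * sin φ) := by
  have hm : MeasurableSet ((univ : Set ℝ) ×ˢ Ioi (0 : ℝ)) := 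
    MeasurableSet.univ.prod measurableSet_Ioi
  have hK' := hK.indicator hm
  have e : ∫⁻ z : ℝ, ∫⁻ ρ in Ioi (0 : ℝ), K (z, ρ) =
      ∫⁻ p : ℝ × ℝ, ((univ : Set ℝ) ×ˢ Ioi (0 : ℝ)).indicator K p := by
    rw [lintegral_indicator hm, Measure.volume_eq_prod, setLIntegral_prod _ (by fun_prop),
      Measure.restrict_univ]
  rw [e, ← lintegral_comp_polarCoord_symm]
  simp only [polarCoord_target, polarCoord_symm_apply, smul_eq_mul]
  rw [Measure.volume_eq_prod, setLIntegral_prod _ (by fun_prop)]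
  refine setLIntegral_congr_fun measurableSet_Ioi fun s hs => ?_
  simp only
  rw [← setLIntegral_congr (Ioo_ae_eq_Icc (a := (0 : ℝ)) (b := π)),
    ← lintegral_indicator measurableSet_Ioo, ← lintegral_indicator measurableSet_Ioo]
  refine lintegral_congr fun φ => ?_
  have hs' : 0 < s := hs
  by_cases h1 : φ ∈ Ioo 0 π
  · have h2 : φ ∈ Ioo (-π) π := ⟨by linarith [h1.1, pi_pos], h1.2⟩
    have h3 : 0 < s * sin φ := mul_pos hs' (sin_pos_of_mem_Ioo h1)
    simp [h1, h2, h3, indicator]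
  · rw [indicator_of_notMem h1]
    by_cases h2 : φ ∈ Ioo (-π) π
    · have h4 : φ ≤ 0 := by
        by_contra h; exact h1 ⟨not_le.1 h, h2.2⟩
      have h3 : s * sin φ ≤ 0 :=
        mul_nonpos_of_nonneg_of_nonpos hs'.le (sin_nonpos_of_nonpos_of_neg_pi_le h4 h2.1.le)
      simp [h2, h3, indicator]
    · rw [indicator_of_notMem h2]

open Real Set in
theorem setLIntegral_sin_mul_comp_cos (F : ℝ → ENNReal) :
    ∫⁻ φ in Icc 0 π, ENNReal.ofReal (sin φ) * F (cos φ) = ∫⁻ t in Icc (-1) 1, F t := by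
  rw [← bijOn_cos.image_eq, lintegral_image_eq_lintegral_abs_deriv_mul measurableSet_Icc
    (fun φ _ => (hasDerivAt_cos φ).hasDerivWithinAt) injOn_cos]
  refine setLIntegral_congr_fun measurableSet_Icc fun φ hφ => ?_
  simp only [abs_neg, abs_of_nonneg (sin_nonneg_of_mem_Icc hφ)]

open Real Set in
theorem volume_cone_inter_ball :
    ∃ C : ENNReal, ∀ T : Set ℝ, MeasurableSet T →
      volume {y : EuclideanSpace ℝ (Fin 3) | ‖y‖ ∈ Ioo (0 : ℝ) 1 ∧ y 0 / ‖y‖ ∈ T} =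
        C * volume (T ∩ Icc (-1) 1) := by
  refine ⟨ENNReal.ofReal (2 * π) * ∫⁻ s in Ioi (0 : ℝ),
    ENNReal.ofReal s * (ENNReal.ofReal s * (Ioo (0 : ℝ) 1).indicator 1 s), fun T hT => ?_⟩
  set H : ℝ × ℝ → ENNReal := fun p =>
    (Ioo (0 : ℝ) 1).indicator 1 (√(p.1 ^ 2 + p.2)) * T.indicator 1 (p.1 / √(p.1 ^ 2 + p.2))
    with hHdef
  have m1 : Measurable ((Ioo (0 : ℝ) 1).indicator (1 : ℝ → ENNReal)) :=
    measurable_one.indicator measurableSet_Ioo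
  have m2 : Measurable (T.indicator (1 : ℝ → ENNReal)) := measurable_one.indicator hT
  have hH : Measurable H := by fun_prop
  have hn : ∀ y : EuclideanSpace ℝ (Fin 3), ‖y‖ = √(y 0 ^ 2 + (y 1 ^ 2 + y 2 ^ 2)) := fun y => by
    rw [EuclideanSpace.norm_eq, Fin.sum_univ_three]
    simp [add_assoc]
  have hms : MeasurableSet
      {y : EuclideanSpace ℝ (Fin 3) | ‖y‖ ∈ Ioo (0 : ℝ) 1 ∧ y 0 / ‖y‖ ∈ T} :=
    (measurable_norm measurableSet_Ioo).inter
      ((show Measurable fun y : EuclideanSpace ℝ (Fin 3) => y 0 / ‖y‖ by fun_prop) hT)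
  rw [← lintegral_indicator_one hms]
  have e : ∀ y : EuclideanSpace ℝ (Fin 3),
      {y : EuclideanSpace ℝ (Fin 3) | ‖y‖ ∈ Ioo (0 : ℝ) 1 ∧ y 0 / ‖y‖ ∈ T}.indicator
        (1 : EuclideanSpace ℝ (Fin 3) → ENNReal) y = H (y 0, y 1 ^ 2 + y 2 ^ 2) := fun y => by
    have h : H (y 0, y 1 ^ 2 + y 2 ^ 2) =
        (Ioo (0 : ℝ) 1).indicator 1 ‖y‖ * T.indicator 1 (y 0 / ‖y‖) := by rw [hn y]
    rw [h]
    simp only [indicator, mem_ofPred_eq, Pi.one_apply]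
    by_cases h1 : ‖y‖ ∈ Ioo (0 : ℝ) 1 <;> by_cases h2 : y 0 / ‖y‖ ∈ T <;> simp [-Set.mem_Ioo, h1, h2]
  rw [lintegral_congr e, lintegral_axisymmetric hH,
    lintegral_halfPlane_polar (K := fun p => ENNReal.ofReal p.2 * H (p.1, p.2 ^ 2)) (by fun_prop),
    mul_assoc]
  congr 1
  rw [← lintegral_mul_const _ (by fun_prop)]
  refine setLIntegral_congr_fun measurableSet_Ioi fun s hs => ?_
  have hs' : 0 < s := hs
  have h1 : ∀ φ : ℝ, √((s * cos φ) ^ 2 + (s * sin φ) ^ 2) = s := fun φ => by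
    rw [show (s * cos φ) ^ 2 + (s * sin φ) ^ 2 = s ^ 2 by
      linear_combination s ^ 2 * sin_sq_add_cos_sq φ, sqrt_sq hs'.le]
  have h2 : ∀ φ : ℝ, s * cos φ / s = cos φ := fun φ => by field_simp
  have h3 : volume (T ∩ Icc (-1) 1) =
      ∫⁻ φ in Icc 0 π, ENNReal.ofReal (sin φ) * T.indicator 1 (cos φ) := by
    rw [setLIntegral_sin_mul_comp_cos, lintegral_indicator_one hT, Measure.restrict_apply hT]
  simp only [hHdef, h1, h2]
  rw [h3, ← lintegral_const_mul _ (by fun_prop)]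
  refine lintegral_congr fun φ => ?_
  rw [ENNReal.ofReal_mul hs'.le]
  ring

instance : IsProbabilityMeasure sphMeasure := by
  refine ⟨?_⟩
  rw [sphMeasure, Measure.smul_apply, smul_eq_mul]
  exact ENNReal.inv_mul_cancel (by
    simpa only [ne_eq, Measure.measure_univ_eq_zero] using Measure.toSphere_ne_zero _) (measure_ne_top _ _)

open Set Pointwise in
/-- Archimedes' hat-box theorem. -/
theorem map_inner_sphMeasure (x : Metric.sphere (0 : EuclideanSpace ℝ (Fin 3)) 1) :
    sphMeasure.map (fun p : Metric.sphere (0 : EuclideanSpace ℝ (Fin 3)) 1 =>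
       inner ℝ (x : EuclideanSpace ℝ (Fin 3)) (p : EuclideanSpace ℝ (Fin 3))) =
      (2⁻¹ : ENNReal) • (volume : Measure ℝ).restrict (Icc (-1) 1) := by
  have hmeas : Measurable fun p : Metric.sphere (0 : EuclideanSpace ℝ (Fin 3)) 1 =>
      inner ℝ (x : EuclideanSpace ℝ (Fin 3)) (p : EuclideanSpace ℝ (Fin 3)) := by fun_prop
  obtain ⟨b, hb⟩ : ∃ b : OrthonormalBasis (Fin 3) ℝ (EuclideanSpace ℝ (Fin 3)), b 0 = x := by
    obtain ⟨b, hb⟩ := Orthonormal.exists_orthonormalBasis_extension_of_card_eq (𝕜 := ℝ)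
      (E := EuclideanSpace ℝ (Fin 3)) (ι := Fin 3) (by simp)
      (v := fun _ => (x : EuclideanSpace ℝ (Fin 3))) (s := {0})
      ⟨fun i => by simp, fun i j h => (h (Subsingleton.elim i j)).elim⟩
    exact ⟨b, hb 0 rfl⟩
  obtain ⟨C, hC⟩ := volume_cone_inter_ball
  have key : ∃ c : ENNReal, sphMeasure.map
      (fun p : Metric.sphere (0 : EuclideanSpace ℝ (Fin 3)) 1 =>
       inner ℝ (x : EuclideanSpace ℝ (Fin 3)) (p : EuclideanSpace ℝ (Fin 3))) =
        c • (volume : Measure ℝ).restrict (Icc (-1) 1) := by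
    refine ⟨((volume : Measure (EuclideanSpace ℝ (Fin 3))).toSphere univ)⁻¹ * (3 * C), ?_⟩
    ext T hT
    rw [Measure.map_apply hmeas hT, sphMeasure, Measure.smul_apply, Measure.smul_apply,
      Measure.restrict_apply hT, smul_eq_mul, smul_eq_mul, Measure.toSphere_apply' _ (hmeas hT),
      mul_assoc, mul_assoc, ← hC T hT]
    congr 2
    · simp
    rw [← b.measurePreserving_repr.measure_preimage_emb
      b.repr.toHomeomorph.measurableEmbedding
      {y : EuclideanSpace ℝ (Fin 3) | ‖y‖ ∈ Ioo (0 : ℝ) 1 ∧ y 0 / ‖y‖ ∈ T}]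
    congr 1
    ext y
    simp only [Set.mem_preimage, mem_ofPred_eq, LinearIsometryEquiv.norm_map, b.repr_apply_apply, hb]
    constructor
    · rintro ⟨r, hr, _, ⟨p, hp, rfl⟩, rfl⟩
      have h1 : ‖r • (p : EuclideanSpace ℝ (Fin 3))‖ = r := by
        simp [norm_smul, abs_of_pos hr.1]
      simp only [h1, inner_smul_right]
      refine ⟨hr, ?_⟩
      rw [mul_div_cancel_left₀ _ hr.1.ne']
      exact hp
    · rintro ⟨h1, h2⟩
      refine ⟨‖y‖, h1, ‖y‖⁻¹ • y, ⟨⟨‖y‖⁻¹ • y, ?_⟩, ?_, rfl⟩, ?_⟩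
      · simp [norm_smul, h1.1.ne']
      · simpa [inner_smul_right, div_eq_inv_mul] using h2
      · simp [smul_smul, h1.1.ne']
  obtain ⟨c, hc⟩ := key
  have h1 := congrArg (fun μ : Measure ℝ => μ univ) hc
  simp only [Measure.map_apply hmeas MeasurableSet.univ, Set.preimage_univ, measure_univ,
    Measure.smul_apply, Measure.restrict_apply_univ, Real.volume_Icc, smul_eq_mul] at h1
  norm_num at h1
  rw [hc, ENNReal.eq_inv_of_mul_eq_one_left h1.symm]

theorem norm_sub_sq_sphere (x p : Metric.sphere (0 : EuclideanSpace ℝ (Fin 3)) 1) :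
    ‖(p : EuclideanSpace ℝ (Fin 3)) - (x : EuclideanSpace ℝ (Fin 3))‖ ^ 2 =
      2 - 2 * inner ℝ (x : EuclideanSpace ℝ (Fin 3)) (p : EuclideanSpace ℝ (Fin 3)) := by
  rw [norm_sub_sq_real, real_inner_comm]
  simp
  ring

theorem intervalIntegrable_log_two_sub :
    IntervalIntegrable (fun t : ℝ => Real.log (2 - 2 * t)) volume (-1) 1 := by
  have h := (intervalIntegral.intervalIntegrable_log' (a := 4) (b := 0)).comp_sub_left 2
  have h2 := h.comp_mul_left (c := 2)
  norm_num at h2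
  exact h2

theorem integrable_log_norm_sub_sq (x : Metric.sphere (0 : EuclideanSpace ℝ (Fin 3)) 1) :
    Integrable (fun p : Metric.sphere (0 : EuclideanSpace ℝ (Fin 3)) 1 =>
      Real.log (‖(p : EuclideanSpace ℝ (Fin 3)) - x‖ ^ 2)) sphMeasure := by
  simp only [norm_sub_sq_sphere]
  have hf : AEMeasurable (fun p : Metric.sphere (0 : EuclideanSpace ℝ (Fin 3)) 1 =>
    inner ℝ (x : EuclideanSpace ℝ (Fin 3)) (p : EuclideanSpace ℝ (Fin 3))) sphMeasure := by fun_prop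
  refine (integrable_map_measure (g := fun t : ℝ => Real.log (2 - 2 * t))
    (Measurable.aestronglyMeasurable (by fun_prop)) hf).1 ?_
  rw [map_inner_sphMeasure]
  refine Integrable.smul_measure ?_ (by simp)
  have := intervalIntegrable_log_two_sub
  rwa [intervalIntegrable_iff_integrableOn_Icc_of_le (by norm_num)] at this

theorem integral_log_norm_sub_sq (x : Metric.sphere (0 : EuclideanSpace ℝ (Fin 3)) 1) :
    ∫ p : Metric.sphere (0 : EuclideanSpace ℝ (Fin 3)) 1,
      Real.log (‖(p : EuclideanSpace ℝ (Fin 3)) - x‖ ^ 2) ∂sphMeasure = Real.log 4 - 1 := by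
  simp only [norm_sub_sq_sphere]
  have hf : AEMeasurable (fun p : Metric.sphere (0 : EuclideanSpace ℝ (Fin 3)) 1 =>
    inner ℝ (x : EuclideanSpace ℝ (Fin 3)) (p : EuclideanSpace ℝ (Fin 3))) sphMeasure := by fun_prop
  rw [← integral_map (f := fun t : ℝ => Real.log (2 - 2 * t)) hf
    (Measurable.aestronglyMeasurable (by fun_prop)), map_inner_sphMeasure, integral_smul_measure,
    integral_Icc_eq_integral_Ioc, ← intervalIntegral.integral_of_le (by norm_num),
    intervalIntegral.integral_comp_sub_mul (fun s => Real.log s) two_ne_zero, integral_log]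
  norm_num
  ring

theorem ae_sphMeasure_ne (x : Metric.sphere (0 : EuclideanSpace ℝ (Fin 3)) 1) :
    ∀ᵐ p ∂sphMeasure, p ≠ x := by
  have hmeas : Measurable fun p : Metric.sphere (0 : EuclideanSpace ℝ (Fin 3)) 1 =>
      inner ℝ (x : EuclideanSpace ℝ (Fin 3)) (p : EuclideanSpace ℝ (Fin 3)) := by fun_prop
  have h : sphMeasure.map (fun p : Metric.sphere (0 : EuclideanSpace ℝ (Fin 3)) 1 =>
       inner ℝ (x : EuclideanSpace ℝ (Fin 3)) (p : EuclideanSpace ℝ (Fin 3))) {1} = 0 := by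
    rw [map_inner_sphMeasure]
    simp
  rw [Measure.map_apply hmeas (measurableSet_singleton _)] at h
  refine measure_mono_null (fun p hp => ?_) h
  obtain rfl : p = x := by simpa using hp
  simp

/-- For points `x₁,…,x_N` on the unit sphere,
`(∫_{S²} ∏_i ‖p − x_i‖² dσ(p))^{1/2} ≥ e^{−κN}` where `κ = 1/2 − log 2`;
equivalently the integral is at least `(4/e)^N`. -/
theorem integral_prod_sq_dist_ge (N : ℕ) (hN : 1 ≤ N)
    (x : Fin N → Metric.sphere (0 : EuclideanSpace ℝ (Fin 3)) 1) :
    Real.exp (-((1 / 2 - Real.log 2) * N)) ≤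
        (∫ p, ∏ i : Fin N,
            ‖(p : EuclideanSpace ℝ (Fin 3)) - (x i : EuclideanSpace ℝ (Fin 3))‖ ^ 2
          ∂sphMeasure) ^ (1 / 2 : ℝ) ∧
      (4 / Real.exp 1) ^ N ≤
        ∫ p, ∏ i : Fin N,
            ‖(p : EuclideanSpace ℝ (Fin 3)) - (x i : EuclideanSpace ℝ (Fin 3))‖ ^ 2
          ∂sphMeasure := by
  have hbound : (4 / Real.exp 1) ^ N ≤
      ∫ p, ∏ i : Fin N,
          ‖(p : EuclideanSpace ℝ (Fin 3)) - (x i : EuclideanSpace ℝ (Fin 3))‖ ^ 2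
        ∂sphMeasure := by
    have hi : Integrable (fun p : Metric.sphere (0 : EuclideanSpace ℝ (Fin 3)) 1 =>
        ∑ i : Fin N, Real.log (‖(p : EuclideanSpace ℝ (Fin 3)) - x i‖ ^ 2)) sphMeasure :=
      integrable_finsetSum _ fun i _ => integrable_log_norm_sub_sq (x i)
    have hae : ∀ᵐ p : Metric.sphere (0 : EuclideanSpace ℝ (Fin 3)) 1 ∂sphMeasure,
        Real.exp (∑ i : Fin N, Real.log (‖(p : EuclideanSpace ℝ (Fin 3)) - x i‖ ^ 2)) =
          ∏ i : Fin N, ‖(p : EuclideanSpace ℝ (Fin 3)) - x i‖ ^ 2 := by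
      filter_upwards [ae_all_iff.2 fun i => ae_sphMeasure_ne (x i)] with p hp
      rw [Real.exp_sum]
      refine Finset.prod_congr rfl fun i _ => Real.exp_log (pow_pos (norm_pos_iff.2 ?_) 2)
      exact sub_ne_zero.2 (Subtype.coe_injective.ne (hp i))
    have hprod : Integrable (fun p : Metric.sphere (0 : EuclideanSpace ℝ (Fin 3)) 1 =>
        ∏ i : Fin N, ‖(p : EuclideanSpace ℝ (Fin 3)) - x i‖ ^ 2) sphMeasure :=
      Continuous.integrable_of_hasCompactSupport (by fun_prop)
        (HasCompactSupport.of_compactSpace _)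
    have hJ := convexOn_exp.map_integral_le (μ := sphMeasure) Real.continuous_exp.continuousOn
      isClosed_univ (by simp) hi (hprod.congr (hae.mono fun p hp => hp.symm))
    rw [integral_congr_ae hae, integral_finsetSum _ fun i _ => integrable_log_norm_sub_sq (x i)]
      at hJ
    simp only [integral_log_norm_sub_sq, sum_const, card_univ, Fintype.card_fin, nsmul_eq_mul]
      at hJ
    rwa [Real.exp_nat_mul, Real.exp_sub, Real.exp_log (by norm_num)] at hJ
  refine ⟨?_, hbound⟩
  have h4 : Real.log 4 = 2 * Real.log 2 := by
    rw [show (4 : ℝ) = 2 ^ 2 by norm_num, Real.log_pow]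
    norm_num
  have h : Real.exp (-((1 / 2 - Real.log 2) * N)) = ((4 / Real.exp 1) ^ N) ^ (1 / 2 : ℝ) := by
    rw [show 4 / Real.exp 1 = Real.exp (Real.log 4 - 1) by
      rw [Real.exp_sub, Real.exp_log (by norm_num)], ← Real.exp_nat_mul, ← Real.exp_mul, h4]
    congr 1
    ring
  rw [h]
  exact Real.rpow_le_rpow (by positivity) hbound (by norm_num)
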